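/- arXiv:1412.8192 — 5 statements merged into one kernel-verified Lean document; each statement's English description precedes it below -/
import Mathlib

section
/- (Generalized Newton–Maclaurin inequality.) Let n ≥ 1 and let λ = (λ_1,…,λ_n) ∈ ℝ^n have all entries positive. Then for every integer α with 1 ≤ α ≤ n−1, one has S_{α+1}(λ)/C_n^{α+1} ≤ (S_1(λ)/n) · (S_α(λ)/C_n^α), i.e. the normalized elementary symmetric means satisfy p_{α+1}(λ) ≤ p_1(λ)·p_α(λ). -/
/-- `S n k lam` is the `k`-th elementary symmetric polynomial of `lam ∈ ℝⁿ`,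
with the conventions `S n 0 lam = 1` and `S n k lam = 0` for `k > n`. -/
noncomputable def S (n k : ℕ) (lam : Fin n → ℝ) : ℝ :=
  ∑ A ∈ Finset.powersetCard k (Finset.univ : Finset (Fin n)), ∏ i ∈ A, lam i

/-- `Si n k i lam` is `S_k` evaluated at `lam` with its `i`-th entry replaced by `0`. -/
noncomputable def Si (n k : ℕ) (i : Fin n) (lam : Fin n → ℝ) : ℝ :=
  S n k (Function.update lam i 0)

namespace Finset

variable {ι : Type*} [DecidableEq ι]

/-- Splitting an elementary symmetric sum according to membership of `a`. -/
theorem sum_powersetCard_succ_insert_prod {R : Type*} [CommSemiring R] {s : Finset ι} {a : ι}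
    (ha : a ∉ s) (k : ℕ) (x : ι → R) :
    ∑ A ∈ powersetCard (k + 1) (insert a s), ∏ i ∈ A, x i =
      ∑ A ∈ powersetCard (k + 1) s, ∏ i ∈ A, x i +
        x a * ∑ A ∈ powersetCard k s, ∏ i ∈ A, x i := by
  have notMem {m : ℕ} {A : Finset ι} (hA : A ∈ powersetCard m s) : a ∉ A :=
    fun h => ha ((mem_powersetCard.1 hA).1 h)
  rw [powersetCard_succ_insert ha, sum_union, sum_image, mul_sum]
  · congr 1
    exact sum_congr rfl fun A hA => prod_insert (notMem hA)
  · intro A hA B hB h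
    rw [← erase_insert (notMem hA), ← erase_insert (notMem hB), h]
  · refine disjoint_left.2 fun A hA hA' => ?_
    obtain ⟨B, -, rfl⟩ := mem_image.1 hA'
    exact notMem hA (mem_insert_self a B)

/-- Each `k`-subset of `s` avoids exactly `#s - k` elements of `s`. -/
theorem sum_sum_powersetCard_erase {R : Type*} [CommRing R] (s : Finset ι) (k : ℕ)
    (f : Finset ι → R) :
    ∑ i ∈ s, ∑ A ∈ powersetCard k (s.erase i), f A =
      ((#s : R) - k) * ∑ A ∈ powersetCard k s, f A := by
  rw [sum_comm' (s := s) (t' := powersetCard k s) (s' := fun A => s \ A), mul_sum]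
  · refine sum_congr rfl fun A hA => ?_
    obtain ⟨hs, hk⟩ := mem_powersetCard.1 hA
    rw [sum_const, nsmul_eq_mul, cast_card_sdiff hs, hk]
  · intro i A
    simp only [mem_powersetCard, mem_sdiff, subset_erase]
    tauto

theorem sum_mul_sum_powersetCard_erase_prod {R : Type*} [CommRing R] (s : Finset ι) (k : ℕ)
    (x : ι → R) :
    ∑ i ∈ s, x i * ∑ A ∈ powersetCard k (s.erase i), ∏ j ∈ A, x j =
      ((k : R) + 1) * ∑ A ∈ powersetCard (k + 1) s, ∏ j ∈ A, x j := by
  have split : ∀ i ∈ s, x i * ∑ A ∈ powersetCard k (s.erase i), ∏ j ∈ A, x j =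
      ∑ A ∈ powersetCard (k + 1) s, ∏ j ∈ A, x j -
        ∑ A ∈ powersetCard (k + 1) (s.erase i), ∏ j ∈ A, x j := by
    intro i hi
    have h := sum_powersetCard_succ_insert_prod (notMem_erase i s) k x
    rw [insert_erase hi] at h
    rw [h, add_sub_cancel_left]
  rw [sum_congr rfl split, sum_sub_distrib, sum_sum_powersetCard_erase, sum_const, nsmul_eq_mul]
  push_cast
  ring

theorem antivaryOn_sum_powersetCard_erase_prod (s : Finset ι) (k : ℕ) {x : ι → ℝ}
    (hx : ∀ i ∈ s, 0 ≤ x i) :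
    AntivaryOn x (fun i => ∑ A ∈ powersetCard k (s.erase i), ∏ j ∈ A, x j) s := by
  intro i hi j hj hlt
  by_contra! hij
  refine hlt.not_ge ?_
  obtain _ | k := k
  · simp
  have hne : i ≠ j := fun h => hij.ne (congrArg x h)
  have hi' : s.erase j = insert i ((s.erase i).erase j) := by
    rw [erase_right_comm, insert_erase (mem_erase.2 ⟨hne, hi⟩)]
  have hj' : s.erase i = insert j ((s.erase i).erase j) := by
    rw [insert_erase (mem_erase.2 ⟨hne.symm, hj⟩)]
  have nonneg : 0 ≤ ∑ A ∈ powersetCard k ((s.erase i).erase j), ∏ l ∈ A, x l :=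
    sum_nonneg fun A hA => prod_nonneg fun l hl =>
      hx l (mem_of_mem_erase (mem_of_mem_erase ((mem_powersetCard.1 hA).1 hl)))
  have h₁ := sum_powersetCard_succ_insert_prod (a := i) (s := (s.erase i).erase j)
    (by simp) k x
  have h₂ := sum_powersetCard_succ_insert_prod (notMem_erase j (s.erase i)) k x
  rw [← hi'] at h₁
  rw [← hj'] at h₂
  simp only [h₁, h₂]
  gcongr

/-- Newton–Maclaurin inequality in the form `n (k + 1) S_{k+1} ≤ (n - k) S_1 S_k`. -/
theorem card_mul_sum_powersetCard_succ_prod_le (s : Finset ι) (k : ℕ) {x : ι → ℝ}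
    (hx : ∀ i ∈ s, 0 ≤ x i) :
    (#s : ℝ) * (((k : ℝ) + 1) * ∑ A ∈ powersetCard (k + 1) s, ∏ i ∈ A, x i) ≤
      (∑ i ∈ s, x i) * (((#s : ℝ) - k) * ∑ A ∈ powersetCard k s, ∏ i ∈ A, x i) := by
  rw [← sum_mul_sum_powersetCard_erase_prod, ← sum_sum_powersetCard_erase]
  exact (antivaryOn_sum_powersetCard_erase_prod s k hx).card_mul_sum_le_sum_mul_sum

end Finset

/-- Generalized Newton–Maclaurin inequality: `p_{α+1}(λ) ≤ p_1(λ) · p_α(λ)`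
for positive `λ`, where `p_k(λ) = S_k(λ)/C_n^k`. -/
theorem newton_maclaurin (n : ℕ) (hn : 1 ≤ n) (lam : Fin n → ℝ)
    (hlam : ∀ i, 0 < lam i) (α : ℕ) (hα1 : 1 ≤ α) (hα2 : α ≤ n - 1) :
    S n (α + 1) lam / (n.choose (α + 1) : ℝ)
      ≤ (S n 1 lam / n) * (S n α lam / (n.choose α : ℝ)) := by
  have key := Finset.card_mul_sum_powersetCard_succ_prod_le Finset.univ α
    fun i _ => (hlam i).le
  have hS₁ : S n 1 lam = ∑ i, lam i := by
    simp [S, Finset.powersetCard_one]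
  rw [Finset.card_univ, Fintype.card_fin, ← hS₁] at key
  change (n : ℝ) * ((α + 1) * S n (α + 1) lam) ≤ S n 1 lam * ((n - α) * S n α lam) at key
  have hn₀ : (0 : ℝ) < n := by exact_mod_cast hn
  have hc : (0 : ℝ) < n.choose α := by exact_mod_cast Nat.choose_pos (by lia)
  have hc' : (0 : ℝ) < n.choose (α + 1) := by exact_mod_cast Nat.choose_pos (by lia)
  have hchoose : (n.choose (α + 1) : ℝ) * (α + 1) = n.choose α * (n - α) := by
    rw [← Nat.cast_sub (by lia : α ≤ n)]
    exact_mod_cast Nat.choose_succ_right_eq n α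
  rw [div_mul_div_comm, div_le_div_iff₀ hc' (by positivity)]
  have hα : (0 : ℝ) < α + 1 := by positivity
  refine le_of_mul_le_mul_right ?_ hα
  calc S n (α + 1) lam * (n * n.choose α) * (α + 1)
      = n.choose α * (n * ((α + 1) * S n (α + 1) lam)) := by ring
    _ ≤ n.choose α * (S n 1 lam * ((n - α) * S n α lam)) := by gcongr
    _ = S n 1 lam * S n α lam * (n.choose α * (n - α)) := by ring
    _ = S n 1 lam * S n α lam * n.choose (α + 1) * (α + 1) := by rw [← hchoose]; ring
end

section
/- Let n ≥ 1 and let λ = (λ_1,…,λ_n) ∈ ℝ^n have all entries positive. Then for every integer α with 1 ≤ α ≤ n, one has Σ_{i=1}^n λ_i^2 · S_{α−1;i}(λ) ≥ (α/n) · S_1(λ) · S_α(λ). -/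
/-- The `k`-th elementary symmetric polynomial of the values of `f` on the finite set `s`. -/
def esymmOn {ι : Type*} (s : Finset ι) (k : ℕ) (f : ι → ℝ) : ℝ :=
  ∑ A ∈ s.powersetCard k, ∏ i ∈ A, f i

lemma esymmOn_zero {ι : Type*} (s : Finset ι) (f : ι → ℝ) : esymmOn s 0 f = 1 := by
  simp [esymmOn]

lemma esymmOn_nonneg {ι : Type*} (s : Finset ι) (k : ℕ) {f : ι → ℝ} (hf : ∀ i, 0 ≤ f i) :
    0 ≤ esymmOn s k f :=
  Finset.sum_nonneg fun _ _ => Finset.prod_nonneg fun i _ => hf i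

lemma esymmOn_congr {ι : Type*} {s : Finset ι} (k : ℕ) {f g : ι → ℝ} (h : ∀ i ∈ s, f i = g i) :
    esymmOn s k f = esymmOn s k g :=
  Finset.sum_congr rfl fun _ hA => Finset.prod_congr rfl fun i hi =>
    h i ((Finset.mem_powersetCard.1 hA).1 hi)

lemma sum_powersetCard_insert_mem {ι : Type*} [DecidableEq ι] {s : Finset ι} {i : ι}
    (hi : i ∉ s) (k : ℕ) (f : ι → ℝ) :
    ∑ A ∈ (s.powersetCard k).image (insert i), ∏ j ∈ A, f j = f i * esymmOn s k f := by
  have hmem : ∀ A ∈ s.powersetCard k, i ∉ A := fun A hA h =>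
    hi ((Finset.mem_powersetCard.1 hA).1 h)
  rw [Finset.sum_image, esymmOn, Finset.mul_sum]
  · exact Finset.sum_congr rfl fun A hA => Finset.prod_insert (hmem A hA)
  · intro A hA B hB h
    rw [← Finset.erase_insert (hmem A hA), ← Finset.erase_insert (hmem B hB), h]

lemma esymmOn_insert_succ {ι : Type*} [DecidableEq ι] {s : Finset ι} {i : ι} (hi : i ∉ s)
    (k : ℕ) (f : ι → ℝ) :
    esymmOn (insert i s) (k + 1) f = esymmOn s (k + 1) f + f i * esymmOn s k f := by
  rw [← sum_powersetCard_insert_mem hi, esymmOn, Finset.powersetCard_succ_insert hi,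
    Finset.sum_union, esymmOn]
  rw [Finset.disjoint_left]
  intro A hA hA'
  obtain ⟨B, -, rfl⟩ := Finset.mem_image.1 hA'
  exact hi ((Finset.mem_powersetCard.1 hA).1 (Finset.mem_insert_self i B))

lemma Si_eq_esymmOn_erase (n k : ℕ) (i : Fin n) (lam : Fin n → ℝ) :
    Si n k i lam = esymmOn (Finset.univ.erase i) k lam := by
  change esymmOn Finset.univ k (Function.update lam i 0) = _
  cases k with
  | zero => simp [esymmOn_zero]
  | succ k =>
    rw [← Finset.insert_erase (Finset.mem_univ i), esymmOn_insert_succ (by simp)]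
    simp only [Function.update_self, zero_mul, add_zero, Finset.insert_erase (Finset.mem_univ i)]
    refine esymmOn_congr _ fun j hj => ?_
    rw [Function.update_of_ne (Finset.ne_of_mem_erase hj)]

lemma mul_esymmOn_erase {ι : Type*} [DecidableEq ι] {s : Finset ι} {i : ι} (hi : i ∈ s)
    (k : ℕ) (f : ι → ℝ) :
    f i * esymmOn (s.erase i) k f =
      ∑ A ∈ s.powersetCard (k + 1), if i ∈ A then ∏ j ∈ A, f j else 0 := by
  have h := esymmOn_insert_succ (Finset.notMem_erase i s) k f
  rw [Finset.insert_erase hi] at h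
  rw [← Finset.sum_filter, eq_sub_of_add_eq' h.symm, esymmOn,
    ← Finset.sum_filter_add_sum_filter_not (s.powersetCard (k + 1)) (i ∈ ·), esymmOn,
    add_sub_assoc, add_eq_left, sub_eq_zero]
  congr 1
  ext A
  simp only [Finset.mem_filter, Finset.mem_powersetCard, Finset.subset_erase]
  tauto

lemma sum_mul_esymmOn_erase {ι : Type*} [DecidableEq ι] (s : Finset ι) (k : ℕ) (f : ι → ℝ) :
    ∑ i ∈ s, f i * esymmOn (s.erase i) k f = (k + 1 : ℕ) * esymmOn s (k + 1) f := by
  rw [Finset.sum_congr rfl fun i hi => mul_esymmOn_erase hi k f, Finset.sum_comm, esymmOn,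
    Finset.mul_sum]
  refine Finset.sum_congr rfl fun A hA => ?_
  obtain ⟨hs, hc⟩ := Finset.mem_powersetCard.1 hA
  rw [← Finset.sum_filter, Finset.filter_mem_eq_inter, Finset.inter_eq_right.2 hs,
    Finset.sum_const, hc, nsmul_eq_mul]

lemma mul_esymmOn_erase_le {ι : Type*} [DecidableEq ι] {s : Finset ι} {i j : ι} (hi : i ∈ s)
    (hj : j ∈ s) (k : ℕ) {f : ι → ℝ} (hf : ∀ i, 0 ≤ f i) (hij : f i ≤ f j) :
    f i * esymmOn (s.erase i) k f ≤ f j * esymmOn (s.erase j) k f := by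
  rcases eq_or_ne i j with rfl | hne
  · rfl
  cases k with
  | zero => simpa [esymmOn_zero] using hij
  | succ k =>
    have h1 : s.erase i = insert j ((s.erase i).erase j) :=
      (Finset.insert_erase (Finset.mem_erase.2 ⟨hne.symm, hj⟩)).symm
    have h2 : s.erase j = insert i ((s.erase i).erase j) := by
      rw [Finset.erase_right_comm, Finset.insert_erase (Finset.mem_erase.2 ⟨hne, hi⟩)]
    rw [h2, esymmOn_insert_succ (by simp), h1, esymmOn_insert_succ (by simp), ← h1]
    nlinarith [mul_le_mul_of_nonneg_right hij
      (esymmOn_nonneg ((s.erase i).erase j) (k + 1) hf)]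

/-- For positive λ, Σ_{i=1}^n λ_i² · S_{α−1;i}(λ) ≥ (α/n) · S_1(λ) · S_α(λ). -/
theorem sum_sq_mul_esymm_update_ge (n : ℕ) (hn : 1 ≤ n) (lam : Fin n → ℝ)
    (hlam : ∀ i, 0 < lam i) (α : ℕ) (hα1 : 1 ≤ α) (hα2 : α ≤ n) :
    ∑ i, (lam i) ^ 2 * Si n (α - 1) i lam ≥ (α / n : ℝ) * S n 1 lam * S n α lam := by
  obtain ⟨k, rfl⟩ := Nat.exists_eq_add_of_le' hα1
  have hn0 : (0 : ℝ) < n := by exact_mod_cast hn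
  have hmono : Monovary lam fun i => lam i * esymmOn (Finset.univ.erase i) k lam := by
    intro i j hij
    by_contra! h
    exact hij.not_ge (mul_esymmOn_erase_le (Finset.mem_univ j) (Finset.mem_univ i) k
      (fun i => (hlam i).le) h.le)
  have hcheb := hmono.sum_mul_sum_le_card_mul_sum
  rw [sum_mul_esymmOn_erase, Fintype.card_fin] at hcheb
  have hS1 : S n 1 lam = ∑ i, lam i := by simp [S, Finset.powersetCard_one]
  have hsum : ∑ i, (lam i) ^ 2 * Si n (k + 1 - 1) i lam =
      ∑ i, lam i * (lam i * esymmOn (Finset.univ.erase i) k lam) := by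
    refine Finset.sum_congr rfl fun i _ => ?_
    rw [Nat.add_sub_cancel, Si_eq_esymmOn_erase]
    ring
  have hS : S n (k + 1) lam = esymmOn Finset.univ (k + 1) lam := rfl
  rw [hsum, hS1, hS, ge_iff_le, div_mul_eq_mul_div, div_mul_eq_mul_div, div_le_iff₀ hn0]
  linarith
end

section
/- Let n ≥ 1, let μ = (μ_1,…,μ_n) ∈ ℝ^n have all entries positive, and let c_1,…,c_n ≥ 0 be nonnegative reals. Then Σ_{i=1}^n Σ_{α=1}^n (c_α/C_n^α) · S_{α−1;i}(μ) · μ_i^2 ≥ (S_1(μ)/n) · Σ_{α=1}^n (c_α/C_n^α) · S_α(μ). -/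
open Finset

theorem S_mono {n k : ℕ} {x y : Fin n → ℝ} (hx : 0 ≤ x) (hxy : x ≤ y) : S n k x ≤ S n k y :=
  sum_le_sum fun _ _ => prod_le_prod (fun i _ => hx i) fun i _ => hxy i

theorem S_comp_perm (n k : ℕ) (x : Fin n → ℝ) (e : Equiv.Perm (Fin n)) :
    S n k (x ∘ e) = S n k x := by
  have h := map_univ_equiv e
  unfold S
  conv_rhs => rw [← h, powersetCard_map, sum_map]
  refine sum_congr rfl fun A _ => ?_
  simp [mapEmbedding]

theorem Si_eq_sum_erase (n k : ℕ) (i : Fin n) (x : Fin n → ℝ) :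
    Si n k i x = ∑ A ∈ powersetCard k (univ.erase i), ∏ j ∈ A, x j := by
  unfold Si S
  symm
  apply sum_subset_zero_on_sdiff (powersetCard_mono (erase_subset i univ))
  · intro A hA
    have hiA : i ∈ A := by
      by_contra h
      simp only [mem_sdiff, mem_powersetCard, subset_univ, true_and] at hA
      exact hA.2 ⟨subset_erase.2 ⟨subset_univ _, h⟩, hA.1⟩
    exact prod_eq_zero hiA (Function.update_self ..)
  · intro A hA
    refine prod_congr rfl fun j hj => ?_
    have := (mem_powersetCard.1 hA).1 hj
    rw [Function.update_of_ne (ne_of_mem_erase this)]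

theorem S_succ_eq_Si_add (n k : ℕ) (i : Fin n) (x : Fin n → ℝ) :
    S n (k + 1) x = Si n (k + 1) i x + x i * Si n k i x := by
  rw [Si_eq_sum_erase, Si_eq_sum_erase, S, ← insert_erase (mem_univ i),
    powersetCard_succ_insert (notMem_erase i univ), sum_union, sum_image, mul_sum,
    erase_insert (notMem_erase i univ)]
  · congr 1
    refine sum_congr rfl fun A hA => prod_insert fun h => ?_
    exact notMem_erase i univ ((mem_powersetCard.1 hA).1 h)
  · intro A hA B hB h
    have hA' : i ∉ A := fun h => notMem_erase i univ ((mem_powersetCard.1 hA).1 h)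
    have hB' : i ∉ B := fun h => notMem_erase i univ ((mem_powersetCard.1 hB).1 h)
    rw [← erase_insert hA', h, erase_insert hB']
  · rw [disjoint_left]
    intro A hA hA'
    obtain ⟨B, -, rfl⟩ := mem_image.1 hA'
    exact notMem_erase i univ ((mem_powersetCard.1 hA).1 (mem_insert_self i B))

theorem Si_anti {n k : ℕ} {x : Fin n → ℝ} (hx : 0 ≤ x) {i j : Fin n} (hij : x i ≤ x j) :
    Si n k j x ≤ Si n k i x := by
  unfold Si
  rw [← S_comp_perm n k (Function.update x i 0) (Equiv.swap i j)]
  apply S_mono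
  · intro l
    by_cases h : l = j
    · simp [h]
    · simpa [h] using hx l
  · intro l
    rcases eq_or_ne l j with rfl | hj
    · simp
    rcases eq_or_ne l i with rfl | hi
    · simpa [hj, hj.symm] using hij
    · simp [Equiv.swap_apply_of_ne_of_ne hi hj, hi, hj]

theorem sum_mul_Si (n k : ℕ) (x : Fin n → ℝ) :
    ∑ i, x i * Si n k i x = (k + 1) * S n (k + 1) x := by
  have h (i : Fin n) : x i * Si n k i x =
      ∑ A ∈ powersetCard (k + 1) univ, if i ∈ A then ∏ j ∈ A, x j else 0 := by
    rw [eq_sub_of_add_eq' (S_succ_eq_Si_add n k i x).symm, Si, S, S, ← sum_sub_distrib]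
    refine sum_congr rfl fun A _ => ?_
    split_ifs with hi
    · rw [prod_eq_zero (f := Function.update x i 0) hi (Function.update_self ..), sub_zero]
    · rw [prod_update_of_notMem hi, sub_self]
  simp_rw [h]
  rw [sum_comm, S, mul_sum]
  refine sum_congr rfl fun A hA => ?_
  simp [(mem_powersetCard.1 hA).2]

theorem S_one_mul_S_le {n k : ℕ} {x : Fin n → ℝ} (hx : 0 ≤ x) :
    S n 1 x * S n (k + 1) x ≤ n * ∑ i, Si n k i x * x i ^ 2 := by
  have hmono : Monovary x fun i => x i * Si n k i x := by
    intro i j h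
    by_contra! hlt
    have := Si_anti (k := k + 1) hx hlt.le
    dsimp only at h
    linarith [S_succ_eq_Si_add n k i x, S_succ_eq_Si_add n k j x]
  have hcheb := hmono.sum_mul_sum_le_card_mul_sum
  rw [sum_mul_Si, Fintype.card_fin] at hcheb
  have hS (m : ℕ) : 0 ≤ S n m x := sum_nonneg fun _ _ => prod_nonneg fun i _ => hx i
  have hS1 : S n 1 x = ∑ i, x i := by simp [S, powersetCard_one]
  calc S n 1 x * S n (k + 1) x ≤ S n 1 x * ((k + 1) * S n (k + 1) x) := by
        gcongr
        · exact hS 1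
        · exact le_mul_of_one_le_left (hS _) (by simp)
    _ ≤ n * ∑ i, x i * (x i * Si n k i x) := by rwa [hS1]
    _ = n * ∑ i, Si n k i x * x i ^ 2 := by
        congr 1
        exact sum_congr rfl fun i _ => by ring

/-- Σ_i Σ_α (c_α/C_n^α)·S_{α−1;i}(μ)·μ_i² ≥ (S_1(μ)/n)·Σ_α (c_α/C_n^α)·S_α(μ)
for positive μ and nonnegative c. -/
theorem sum_sum_mul_esymm_update_ge (n : ℕ) (hn : 1 ≤ n) (μ : Fin n → ℝ)
    (hμ : ∀ i, 0 < μ i) (c : ℕ → ℝ) (hc : ∀ α ∈ Finset.Icc 1 n, 0 ≤ c α) :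
    ∑ i, ∑ α ∈ Finset.Icc 1 n, (c α / (n.choose α : ℝ)) * Si n (α - 1) i μ * (μ i) ^ 2
      ≥ (S n 1 μ / n) * ∑ α ∈ Finset.Icc 1 n, (c α / (n.choose α : ℝ)) * S n α μ := by
  rw [sum_comm, mul_sum]
  refine sum_le_sum fun α hα => ?_
  obtain ⟨k, rfl⟩ := Nat.exists_eq_add_of_le' (mem_Icc.1 hα).1
  have hn' : (0 : ℝ) < n := by exact_mod_cast hn
  have hle : S n 1 μ / n * S n (k + 1) μ ≤ ∑ i, Si n k i μ * μ i ^ 2 := by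
    rw [div_mul_eq_mul_div, div_le_iff₀' hn']
    exact S_one_mul_S_le fun i => (hμ i).le
  simp_rw [Nat.add_sub_cancel, mul_assoc, ← mul_sum]
  rw [mul_left_comm]
  exact mul_le_mul_of_nonneg_left hle (div_nonneg (hc _ hα) (Nat.cast_nonneg _))
end

section
/- Let n ≥ 1, let X = diag(λ_1,…,λ_n) be a diagonal positive definite n×n Hermitian matrix, set μ_i = 1/λ_i, let H be an n×n Hermitian matrix, and let α be an integer with 1 ≤ α ≤ n. Then the function t ↦ S_α((X + tH)^{−1}) is differentiable at t = 0 and (d/dt)|_{t=0} S_α((X + tH)^{−1}) = −Σ_{i=1}^n S_{α−1;i}(μ) · μ_i^2 · H_{ii}. -/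
open scoped ComplexOrder

/-- `Sm α Y` is the `α`-th elementary symmetric polynomial of the eigenvalues of `Y`,
i.e. `(−1)^α` times the coefficient of `t^{n−α}` in the characteristic polynomial
`det (t·I − Y)` (for Hermitian `Y` this is real, so we take the real part). -/
noncomputable def Sm {n : ℕ} (α : ℕ) (Y : Matrix (Fin n) (Fin n) ℂ) : ℝ :=
  ((-1 : ℂ) ^ α * Y.charpoly.coeff (n - α)).re

section InverseDerivative

open scoped Matrix.Norms.Operator

/-- The entries of the inverse of `A + t • H` are differentiable at `t = 0` when `A` is
invertible, with derivative the entries of `-(A⁻¹ * H * A⁻¹)`. -/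
theorem Matrix.hasDerivAt_inv_add_smul_apply {m : Type*} [Fintype m] [DecidableEq m]
    (A H : Matrix m m ℂ) (hA : IsUnit A) (i j : m) :
    HasDerivAt (fun t : ℝ => (A + (t : ℂ) • H)⁻¹ i j) (-(A⁻¹ * H * A⁻¹) i j) 0 := by
  obtain ⟨u, rfl⟩ := hA
  have hline : HasDerivAt (fun t : ℝ => (u : Matrix m m ℂ) + t • H) H 0 := by
    exact (((hasDerivAt_id (0 : ℝ)).smul_const H).const_add (u : Matrix m m ℂ)).congr_deriv
      (one_smul ℝ H)
  have hinv := (hasFDerivAt_ringInverse (𝕜 := ℝ) u).comp_hasDerivAt_of_eq (0 : ℝ) hline (by simp)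
  have h := hasDerivAt_pi.1 (hasDerivAt_pi.1 hinv i) j
  refine (h.congr_of_eventuallyEq (.of_forall fun t => ?_)).congr_deriv ?_
  · simp only [Matrix.nonsing_inv_eq_ringInverse, Function.comp_apply, Complex.coe_smul]
  · rw [← Matrix.coe_units_inv]
    rfl

end InverseDerivative

/-- Jacobi's formula at a diagonal matrix: only the diagonal entries of the derivative
contribute to the derivative of the determinant. -/
theorem Matrix.hasDerivAt_det_of_eq_diagonal {m : Type*} [Fintype m] [DecidableEq m]
    {Y : ℝ → Matrix m m ℂ} {Y' : Matrix m m ℂ} {d : m → ℂ} {t₀ : ℝ}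
    (hY : ∀ i j, HasDerivAt (fun t => Y t i j) (Y' i j) t₀)
    (hd : Y t₀ = Matrix.diagonal d) :
    HasDerivAt (fun t => (Y t).det) (∑ i, (∏ j ∈ Finset.univ.erase i, d j) * Y' i i) t₀ := by
  simp only [Matrix.det_apply']
  have h := HasDerivAt.fun_sum (u := (Finset.univ : Finset (Equiv.Perm m))) fun σ _ =>
    (HasDerivAt.fun_finsetProd (u := (Finset.univ : Finset m))
      fun i _ => hY (σ i) i).const_mul ((Equiv.Perm.sign σ : ℤ) : ℂ)
  refine h.congr_deriv ?_
  rw [Finset.sum_eq_single (1 : Equiv.Perm m) _ (by simp)]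
  · simp [hd]
  · intro σ _ hσ
    rw [Finset.sum_eq_zero, mul_zero]
    intro i _
    obtain ⟨j, hj⟩ : ∃ j, σ j ≠ j := by
      by_contra! hc
      exact hσ (Equiv.ext hc)
    obtain ⟨k, hki, hk⟩ : ∃ k, k ≠ i ∧ σ k ≠ k := by
      by_cases hji : j = i
      · exact ⟨σ j, hji ▸ hj, fun hc => hj (σ.injective hc)⟩
      · exact ⟨j, hji, hj⟩
    rw [Finset.prod_eq_zero (i := k) (by simp [hki]), zero_smul]
    rw [hd, Matrix.diagonal_apply_ne _ hk]

/-- `Sm` as a sum of principal minors. -/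
theorem Sm_eq_sum_minors {n α : ℕ} (hα : α ≤ n) (Y : Matrix (Fin n) (Fin n) ℂ) :
    Sm α Y = (∑ s ∈ Finset.univ.powersetCard α,
      (Y.submatrix (Subtype.val : s → Fin n) (Subtype.val : s → Fin n)).det).re := by
  have h := Y.charpoly_coeff_eq_sum_minors α (by simpa using hα)
  rw [Fintype.card_fin] at h
  rw [Sm, h, ← mul_assoc, ← mul_pow]
  simp

/-- `Si n k i` sums only over the subsets avoiding `i`. -/
theorem Si_eq_sum_filter (n k : ℕ) (i : Fin n) (μ : Fin n → ℝ) :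
    Si n k i μ =
      ∑ A ∈ (Finset.univ.powersetCard k).filter (fun A : Finset (Fin n) => i ∉ A),
        ∏ j ∈ A, μ j := by
  rw [Si, S, Finset.sum_filter]
  refine Finset.sum_congr rfl fun A _ => ?_
  split_ifs with h
  · exact Finset.prod_eq_zero h (Function.update_self _ _ _)
  · exact Finset.prod_congr rfl fun j hj =>
      Function.update_of_ne (fun hc => h (by rwa [← hc])) _ _

/-- Summing over the pairs `i ∈ s` with `s.card = k + 1` amounts to summing over `i`
and the `k`-element sets `s.erase i` avoiding `i`. -/
theorem sum_powersetCard_succ_sum_prod_erase (n k : ℕ) (μ c : Fin n → ℝ) :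
    ∑ s ∈ (Finset.univ : Finset (Fin n)).powersetCard (k + 1),
      ∑ i ∈ s, (∏ j ∈ s.erase i, μ j) * c i = ∑ i, Si n k i μ * c i := by
  rw [Finset.sum_comm' (t' := Finset.univ)
    (s' := fun i => (Finset.univ.powersetCard (k + 1)).filter (fun s => i ∈ s)) (by simp)]
  refine Finset.sum_congr rfl fun i _ => ?_
  rw [Si_eq_sum_filter, Finset.sum_mul]
  refine Finset.sum_bij' (fun s _ => s.erase i) (fun A _ => insert i A) ?_ ?_ ?_ ?_ ?_
  · intro s hs
    simp only [Finset.mem_filter, Finset.mem_powersetCard_univ] at hs ⊢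
    simp [Finset.card_erase_of_mem hs.2, hs.1]
  · intro A hA
    simp only [Finset.mem_filter, Finset.mem_powersetCard_univ] at hA ⊢
    simp [Finset.card_insert_of_notMem hA.2, hA.1]
  · intro s hs
    exact Finset.insert_erase (Finset.mem_filter.1 hs).2
  · intro A hA
    exact Finset.erase_insert (Finset.mem_filter.1 hA).2
  · intro s _
    rfl

/-- First variation of `t ↦ S_α((X + tH)⁻¹)` at `t = 0` for diagonal positive
definite `X = diag(λ)` and Hermitian `H`, with `μ_i = 1/λ_i`:
the derivative equals `−Σ_i S_{α−1;i}(μ)·μ_i²·H_{ii}`. -/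
theorem hasDerivAt_esymm_inv (n : ℕ) (hn : 1 ≤ n) (lam : Fin n → ℝ)
    (hlam : ∀ i, 0 < lam i) (μ : Fin n → ℝ) (hμ : ∀ i, μ i = 1 / lam i)
    (H : Matrix (Fin n) (Fin n) ℂ) (hH : H.IsHermitian)
    (α : ℕ) (hα1 : 1 ≤ α) (hα2 : α ≤ n) :
    HasDerivAt
      (fun t : ℝ => Sm α ((Matrix.diagonal (fun i => (lam i : ℂ)) + (t : ℂ) • H)⁻¹))
      (-∑ i, Si n (α - 1) i μ * (μ i) ^ 2 * (H i i).re) 0 := by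
  have hne : ∀ i, (lam i : ℂ) ≠ 0 := fun i => by exact_mod_cast (hlam i).ne'
  have hunit : IsUnit (Matrix.diagonal fun i => (lam i : ℂ)) := by
    rw [Matrix.isUnit_diagonal, Pi.isUnit_iff]
    exact fun i => (hne i).isUnit
  have hinv : (Matrix.diagonal fun i => (lam i : ℂ))⁻¹ = Matrix.diagonal fun i => (μ i : ℂ) := by
    refine Matrix.inv_eq_left_inv ?_
    rw [Matrix.diagonal_mul_diagonal, ← Matrix.diagonal_one]
    congr 1
    funext i
    simp [hμ, hne i]
  have hentry := Matrix.hasDerivAt_inv_add_smul_apply _ H hunit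
  have hminor : ∀ s : Finset (Fin n), HasDerivAt
      (fun t : ℝ => (((Matrix.diagonal (fun i => (lam i : ℂ)) + (t : ℂ) • H)⁻¹).submatrix
        (Subtype.val : s → Fin n) (Subtype.val : s → Fin n)).det)
      (∑ i ∈ s, (∏ j ∈ s.erase i, (μ j : ℂ)) * -((μ i : ℂ) ^ 2 * H i i)) 0 := by
    intro s
    have h := Matrix.hasDerivAt_det_of_eq_diagonal
      (Y := fun t : ℝ => ((Matrix.diagonal (fun i => (lam i : ℂ)) + (t : ℂ) • H)⁻¹).submatrix
        (Subtype.val : s → Fin n) (Subtype.val : s → Fin n))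
      (Y' := Matrix.of fun i j => -((Matrix.diagonal fun i => (lam i : ℂ))⁻¹ * H *
        (Matrix.diagonal fun i => (lam i : ℂ))⁻¹) i.1 j.1)
      (d := fun i => (μ i : ℂ)) (t₀ := 0) (fun i j => hentry i j) (by
        simp only [Complex.ofReal_zero, zero_smul, add_zero, hinv]
        exact Matrix.submatrix_diagonal _ _ Subtype.val_injective)
    refine h.congr_deriv ?_
    rw [← Finset.sum_coe_sort s]
    refine Finset.sum_congr rfl fun i _ => ?_
    congr 1
    · refine Finset.prod_bij (fun j _ => j.1) ?_ ?_ ?_ ?_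
      · intro j hj
        exact Finset.mem_erase.2
          ⟨fun hc => Finset.ne_of_mem_erase hj (Subtype.ext hc), j.2⟩
      · intro a _ b _ hab
        exact Subtype.ext hab
      · intro b hb
        exact ⟨⟨b, Finset.mem_of_mem_erase hb⟩,
          Finset.mem_erase.2 ⟨fun hc => Finset.ne_of_mem_erase hb (congrArg Subtype.val hc),
            Finset.mem_univ _⟩, rfl⟩
      · intro _ _
        rfl
    · simp only [hinv, Matrix.of_apply, Matrix.mul_diagonal, Matrix.diagonal_mul]
      ring
  have hsum := HasDerivAt.fun_sum (u := Finset.univ.powersetCard α) fun s _ => hminor s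
  have hre := Complex.reCLM.hasFDerivAt.comp_hasDerivAt (0 : ℝ) hsum
  simp only [Sm_eq_sum_minors hα2]
  refine hre.congr_deriv ?_
  obtain ⟨k, rfl⟩ := Nat.exists_eq_add_of_le' hα1
  have hcomb := sum_powersetCard_succ_sum_prod_erase n k μ (fun i => -((μ i) ^ 2 * (H i i).re))
  rw [Complex.reCLM_apply, Complex.re_sum]
  simp only [Complex.re_sum, Nat.add_sub_cancel]
  trans ∑ i, Si n k i μ * -((μ i) ^ 2 * (H i i).re)
  · rw [← hcomb]
    refine Finset.sum_congr rfl fun s _ => Finset.sum_congr rfl fun i _ => ?_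
    rw [← Complex.ofReal_prod, Complex.re_ofReal_mul, Complex.neg_re, ← Complex.ofReal_pow,
      Complex.re_ofReal_mul]
  · rw [← Finset.sum_neg_distrib]
    exact Finset.sum_congr rfl fun i _ => by ring
end

section
/- Let n ≥ 1 and let α be an integer with 1 ≤ α ≤ n. The function Y ↦ S_α(Y^{−1}) is convex on the convex set of n×n positive definite Hermitian matrices; equivalently, Y ↦ −S_α(Y^{−1}) is concave there. -/
open scoped ComplexOrder

namespace Matrix

variable {n : Type*} [Fintype n] [DecidableEq n]

/-- Two positive definite matrices are simultaneously congruent to the identity and to a positive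
diagonal matrix. -/
theorem PosDef.exists_eq_mul_conjTranspose_and_eq_mul_diagonal_mul_conjTranspose
    {A B : Matrix n n ℂ} (hA : A.PosDef) (hB : B.PosDef) :
    ∃ (P : Matrix n n ℂ) (d : n → ℝ), (∀ i, 0 < d i) ∧
      A = P * Pᴴ ∧ B = P * diagonal (fun i => (d i : ℂ)) * Pᴴ := by
  obtain ⟨K, hK⟩ : ∃ K : Matrix n n ℂ, A = star K * K := by
    open scoped MatrixOrder in
    exact CStarAlgebra.nonneg_iff_eq_star_mul_self.mp hA.posSemidef.nonneg
  have hKu : IsUnit K := by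
    have h := hA.isUnit
    rw [hK, isUnit_iff_isUnit_det, det_mul] at h
    exact (isUnit_iff_isUnit_det K).mpr (isUnit_of_mul_isUnit_right h)
  have hKd : IsUnit K.det := (isUnit_iff_isUnit_det K).mp hKu
  have hKd' : IsUnit Kᴴ.det := (isUnit_iff_isUnit_det _).mp hKu.star
  have hZ : ((K⁻¹)ᴴ * B * K⁻¹).PosDef :=
    hB.conjTranspose_mul_mul_same
      (mulVec_injective_of_isUnit ((isUnit_nonsing_inv_iff).mpr hKu))
  set U : Matrix n n ℂ := (hZ.1.eigenvectorUnitary : Matrix n n ℂ) with hU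
  have hUU : U * star U = 1 := Unitary.coe_mul_star_self _
  have hsp := hZ.1.spectral_theorem
  have hev : (RCLike.ofReal ∘ hZ.1.eigenvalues : n → ℂ) =
      fun i => (hZ.1.eigenvalues i : ℂ) := rfl
  rw [Unitary.conjStarAlgAut_apply, ← hU, hev] at hsp
  refine ⟨Kᴴ * U, hZ.1.eigenvalues, hZ.eigenvalues_pos, ?_, ?_⟩
  · rw [hK, conjTranspose_mul, conjTranspose_conjTranspose, star_eq_conjTranspose]
    rw [star_eq_conjTranspose] at hUU
    rw [Matrix.mul_assoc Kᴴ, ← Matrix.mul_assoc U, hUU, Matrix.one_mul]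
  · have hB' : B = Kᴴ * ((K⁻¹)ᴴ * B * K⁻¹) * K := by
      rw [conjTranspose_nonsing_inv, Matrix.mul_assoc, Matrix.mul_assoc, Matrix.mul_assoc,
        nonsing_inv_mul _ hKd, Matrix.mul_one, ← Matrix.mul_assoc, mul_nonsing_inv _ hKd',
        Matrix.one_mul]
    refine hB'.trans ((congrArg (fun M => Kᴴ * M * K) hsp).trans ?_)
    rw [conjTranspose_mul, conjTranspose_conjTranspose, star_eq_conjTranspose]
    simp only [Matrix.mul_assoc]

theorem charpoly_inv_mul_diagonal_mul_conjTranspose {P : Matrix n n ℂ} {d : n → ℝ}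
    (hd : ∀ i, 0 < d i) :
    (P * diagonal (fun i => (d i : ℂ)) * Pᴴ)⁻¹.charpoly =
      (diagonal (fun i => (((d i)⁻¹ : ℝ) : ℂ)) * (P⁻¹ * (P⁻¹)ᴴ)).charpoly := by
  have hD : (diagonal (fun i => (d i : ℂ)))⁻¹ = diagonal (fun i => (((d i)⁻¹ : ℝ) : ℂ)) := by
    refine inv_eq_right_inv ?_
    rw [diagonal_mul_diagonal, ← diagonal_one]
    congr 1
    ext i
    have : (d i : ℂ) ≠ 0 := by exact_mod_cast (hd i).ne'
    simp [this]
  rw [mul_inv_rev, mul_inv_rev, hD, charpoly_mul_comm, conjTranspose_nonsing_inv,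
    Matrix.mul_assoc]

theorem det_submatrix_diagonal_mul {R : Type*} [CommRing R] (e : n → R) (M : Matrix n n R)
    (s : Finset n) :
    ((diagonal e * M).submatrix (Subtype.val : s → n) Subtype.val).det =
      (∏ i ∈ s, e i) * (M.submatrix (Subtype.val : s → n) Subtype.val).det := by
  rw [← Finset.prod_coe_sort, ← det_diagonal, ← det_mul]
  congr 1
  ext i j
  simp [diagonal_mul]

end Matrix

theorem Sm_diagonal_mul {n α : ℕ} (hα : α ≤ n) (e : Fin n → ℝ) (M : Matrix (Fin n) (Fin n) ℂ) :
    Sm α (Matrix.diagonal (fun i => (e i : ℂ)) * M) =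
      ∑ s ∈ Finset.powersetCard α Finset.univ, (∏ i ∈ s, e i) *
        (M.submatrix (Subtype.val : s → Fin n) Subtype.val).det.re := by
  have h := Matrix.charpoly_coeff_eq_sum_minors
    (Matrix.diagonal (fun i => (e i : ℂ)) * M) α (by simpa using hα)
  rw [Fintype.card_fin] at h
  rw [Sm, h, ← mul_assoc, ← mul_pow]
  simp only [mul_neg, mul_one, neg_neg, one_pow, one_mul, Complex.re_sum,
    Matrix.det_submatrix_diagonal_mul]
  refine Finset.sum_congr rfl fun s _ => ?_
  rw [← Complex.ofReal_prod, Complex.re_ofReal_mul]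

/-- The function `x ↦ ∏ (x i)⁻¹` is convex on the positive orthant. -/
theorem prod_inv_add_le {ι : Type*} (s : Finset ι) {x y : ι → ℝ} (hx : ∀ i, 0 < x i)
    (hy : ∀ i, 0 < y i) {a b : ℝ} (ha : 0 ≤ a) (hb : 0 ≤ b) (hab : a + b = 1) :
    ∏ i ∈ s, (a * x i + b * y i)⁻¹ ≤ a * ∏ i ∈ s, (x i)⁻¹ + b * ∏ i ∈ s, (y i)⁻¹ := by
  have hX : 0 ≤ ∏ i ∈ s, (x i)⁻¹ := Finset.prod_nonneg fun i _ => (inv_pos.mpr (hx i)).le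
  have hY : 0 ≤ ∏ i ∈ s, (y i)⁻¹ := Finset.prod_nonneg fun i _ => (inv_pos.mpr (hy i)).le
  refine le_trans ?_ (Real.geom_mean_le_arith_mean2_weighted ha hb hX hY hab)
  rw [← Real.finsetProd_rpow _ _ fun i _ => (inv_pos.mpr (hx i)).le,
    ← Real.finsetProd_rpow _ _ fun i _ => (inv_pos.mpr (hy i)).le, ← Finset.prod_mul_distrib]
  have hpos : ∀ i, 0 < x i ^ a * y i ^ b := fun i =>
    mul_pos (Real.rpow_pos_of_pos (hx i) a) (Real.rpow_pos_of_pos (hy i) b)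
  have hle : ∀ i, x i ^ a * y i ^ b ≤ a * x i + b * y i := fun i =>
    Real.geom_mean_le_arith_mean2_weighted ha hb (hx i).le (hy i).le hab
  refine Finset.prod_le_prod (fun i _ => inv_nonneg.mpr ((hpos i).trans_le (hle i)).le)
    fun i _ => ?_
  rw [Real.inv_rpow (hx i).le, Real.inv_rpow (hy i).le, ← mul_inv]
  exact inv_anti₀ (hpos i) (hle i)

/-- `Y ↦ S_α(Y⁻¹)` is convex on the convex set of positive definite Hermitian
matrices; equivalently `Y ↦ −S_α(Y⁻¹)` is concave there. -/
theorem convexOn_esymm_inv (n : ℕ) (hn : 1 ≤ n) (α : ℕ) (hα1 : 1 ≤ α) (hα2 : α ≤ n) :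
    ConvexOn ℝ {Y : Matrix (Fin n) (Fin n) ℂ | Y.PosDef} (fun Y => Sm α Y⁻¹) ∧
    ConcaveOn ℝ {Y : Matrix (Fin n) (Fin n) ℂ | Y.PosDef} (fun Y => -Sm α Y⁻¹) := by
  suffices h : ConvexOn ℝ {Y : Matrix (Fin n) (Fin n) ℂ | Y.PosDef} (fun Y => Sm α Y⁻¹) from
    ⟨h, h.neg⟩
  refine ⟨convex_iff_forall_pos.mpr fun A hA B hB a b ha hb _ => (hA.smul ha).add (hB.smul hb),
    fun A hA B hB a b ha hb hab => ?_⟩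
  obtain ⟨P, d, hd, rfl, rfl⟩ :=
    Matrix.PosDef.exists_eq_mul_conjTranspose_and_eq_mul_diagonal_mul_conjTranspose hA hB
  have hSm : ∀ e : Fin n → ℝ, (∀ i, 0 < e i) →
      Sm α (P * Matrix.diagonal (fun i => (e i : ℂ)) * P.conjTranspose)⁻¹ =
        ∑ s ∈ Finset.powersetCard α Finset.univ, (∏ i ∈ s, (e i)⁻¹) *
          ((P⁻¹ * (P⁻¹).conjTranspose).submatrix
            (Subtype.val : s → Fin n) Subtype.val).det.re := fun e he => by
    rw [← Sm_diagonal_mul hα2, Sm, Matrix.charpoly_inv_mul_diagonal_mul_conjTranspose he, Sm]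
  have hone : P * P.conjTranspose =
      P * Matrix.diagonal (fun _ => ((1 : ℝ) : ℂ)) * P.conjTranspose := by
    simp
  have hcomb : a • (P * P.conjTranspose) +
      b • (P * Matrix.diagonal (fun i => (d i : ℂ)) * P.conjTranspose) =
      P * Matrix.diagonal (fun i => ((a * 1 + b * d i : ℝ) : ℂ)) * P.conjTranspose := by
    have hdiag : Matrix.diagonal (fun i => ((a * 1 + b * d i : ℝ) : ℂ)) =
        a • (1 : Matrix (Fin n) (Fin n) ℂ) + b • Matrix.diagonal (fun i => (d i : ℂ)) := by
      ext i j
      by_cases hij : i = j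
      · subst hij; simp
      · simp [hij]
    rw [hdiag, Matrix.mul_add, Matrix.add_mul, Matrix.mul_smul, Matrix.mul_smul, Matrix.mul_one,
      Matrix.smul_mul, Matrix.smul_mul]
  have hpos : ∀ i, 0 < a * 1 + b * d i := fun i => by
    rcases ha.eq_or_lt with rfl | ha'
    · have hb1 : b = 1 := by linarith
      simpa [hb1] using hd i
    · have := mul_nonneg hb (hd i).le
      linarith
  dsimp only
  rw [hcomb, hSm _ hpos, hSm d hd, hone, hSm (fun _ => 1) fun _ => one_pos, smul_eq_mul,
    smul_eq_mul, Finset.mul_sum, Finset.mul_sum, ← Finset.sum_add_distrib]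
  refine Finset.sum_le_sum fun s _ => ?_
  rw [← mul_assoc, ← mul_assoc, ← add_mul]
  refine mul_le_mul_of_nonneg_right
    (prod_inv_add_le s (x := fun _ => 1) (fun _ => one_pos) hd ha hb hab) ?_
  exact (Complex.nonneg_iff.mp (((Matrix.posSemidef_self_mul_conjTranspose P⁻¹).submatrix
    (Subtype.val : s → Fin n)).det_nonneg)).1
end
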